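/- arXiv:math/0410406 — 2 statements merged into one kernel-verified Lean document; each statement's English description precedes it below -/
import Mathlib

section
/- Let X be an infinite set of singular cardinality κ. A submonoid M of the full transformation monoid O^(1) with S ⊆ M is precomplete if and only if M equals the monoid A' = {f ∈ O^(1) : there exists ξ < κ such that |f⁻¹[{x}]| ≤ ξ for almost all x ∈ X}, or M equals G_ξ or M_ξ for ξ = 1 or for some infinite cardinal ξ with ℵ₀ ≤ ξ ≤ κ. -/
open Cardinal

universe u

/-- The submonoid of all permutations inside the full transformation monoid `Function.End X`. -/
def permSubmonoid (X : Type u) : Submonoid (Function.End X) where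
  carrier := {f | Function.Bijective f}
  mul_mem' hf hg := hf.comp hg
  one_mem' := Function.bijective_id

/-- A submonoid `C ≠ O⁽¹⁾` is precomplete iff together with any function outside of it,
it generates the full transformation monoid. -/
def Precomplete {X : Type u} (C : Submonoid (Function.End X)) : Prop :=
  C ≠ ⊤ ∧ ∀ f : Function.End X, f ∉ C →
    Submonoid.closure ((C : Set (Function.End X)) ∪ {f}) = ⊤

/-- `f` is `ξ`-injective: `f` is injective off a set of cardinality `< ξ`. -/
def XiInjective {X : Type u} (ξ : Cardinal.{u}) (f : Function.End X) : Prop :=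
  ∃ Y : Set X, #Y < ξ ∧ Set.InjOn f Yᶜ

/-- `f` is `ξ`-surjective: the complement of its range has cardinality `< ξ`. -/
def XiSurjective {X : Type u} (ξ : Cardinal.{u}) (f : Function.End X) : Prop :=
  #((Set.range f)ᶜ : Set X) < ξ

/-- The set `A` of functions almost all of whose fibers are small. -/
def monA (X : Type u) : Set (Function.End X) :=
  {f | #{y : X | ¬ #(f ⁻¹' {y}) < #X} < #X}

/-- The set `A'` of functions `f` such that for some `ξ < |X|`, almost all fibers of `f`
have cardinality at most `ξ`. -/
def monA' (X : Type u) : Set (Function.End X) :=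
  {f | ∃ ξ : Cardinal.{u}, ξ < #X ∧ #{x : X | ¬ #(f ⁻¹' {x}) ≤ ξ} < #X}

/-- The set `G_ξ` of functions which are `ξ`-injective or not `ξ`-surjective. -/
def monG (X : Type u) (ξ : Cardinal.{u}) : Set (Function.End X) :=
  {f | XiInjective ξ f ∨ ¬ XiSurjective ξ f}

/-- The set `M_ξ` of functions which are `ξ`-surjective or not `ξ`-injective. -/
def monM (X : Type u) (ξ : Cardinal.{u}) : Set (Function.End X) :=
  {f | XiSurjective ξ f ∨ ¬ XiInjective ξ f}

/-- The kernel sequence of `f` assigns to every cardinal `ξ` the number of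
(nonempty) fibers of `f` of cardinality `ξ`. -/
noncomputable def kernelSeq {X : Type u} (f : X → X) (ξ : Cardinal.{u}) : Cardinal.{u} :=
  #{A : Set X // (∃ y : X, A = f ⁻¹' {y}) ∧ A.Nonempty ∧ #A = ξ}

/-- The set `R`: the range of the sequence `(n i)` together with all infinite
successor cardinals `≤ κ`. -/
def setR (κ : Cardinal.{u}) (n : ℕ → ℕ) : Set Cardinal.{u} :=
  (Set.range fun i : ℕ => (n i : Cardinal.{u})) ∪
    {ξ | ℵ₀ ≤ ξ ∧ ξ ≤ κ ∧ ∃ μ : Cardinal.{u}, ξ = Order.succ μ}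

/-- The sum of a set of cardinals. -/
noncomputable def setSum (A : Set Cardinal.{u}) : Cardinal.{u + 1} :=
  Cardinal.sum fun η : A => (η : Cardinal.{u})

section MaximalMonoids

open Function Set

section Permutations

variable {X D : Type u}

theorem exists_perm_comp_eq {e t : D → X} (he : Injective e) (ht : Injective t)
    (h : #((range e)ᶜ : Set X) = #((range t)ᶜ : Set X)) :
    ∃ π : Equiv.Perm X, ∀ d, π (e d) = t d := by
  let E := Equiv.ofInjective e he
  let f : range e ↪ X := ⟨fun x => t (E.symm x), ht.comp E.symm.injective⟩
  have hf : range f = range t := E.symm.surjective.range_comp t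
  obtain ⟨π, hπ⟩ := extend_function f (by rw [hf]; exact Cardinal.eq.1 h)
  refine ⟨π, fun d => ?_⟩
  have := hπ (E d)
  simpa [f, E] using this

theorem exists_perm_mapsTo [Infinite X] {Y A : Set X} (hY : #Y < #X) (h : #Y ≤ #A) :
    ∃ π : Equiv.Perm X, ∀ y ∈ Y, π y ∈ A := by
  obtain ⟨j⟩ := h
  obtain ⟨π, hπ⟩ := exists_perm_comp_eq (D := Y) (e := Subtype.val) (t := fun y => (j y : X))
    Subtype.val_injective (Subtype.val_injective.comp j.injective) (by
      rw [mk_compl_of_infinite _ (by simpa using hY), mk_compl_of_infinite _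
        (mk_range_le.trans_lt hY)])
  exact ⟨π, fun y hy => by rw [hπ ⟨y, hy⟩]; exact (j _).2⟩

theorem mk_compl_range_comp {f g : X → X} (hf : Injective f) :
    #((range (f ∘ g))ᶜ : Set X) = #((range f)ᶜ : Set X) + #((range g)ᶜ : Set X) := by
  rw [range_comp, ← mk_image_eq (s := (range g)ᶜ) hf, ← mk_union_of_disjoint]
  · congr 2
    ext x
    by_cases hx : x ∈ range f
    · obtain ⟨y, rfl⟩ := hx
      simp [hf.eq_iff]
    · simp only [mem_compl_iff, mem_union, hx, not_false_eq_true, true_or, iff_true]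
      exact fun h => hx (image_subset_range _ _ h)
  · exact (disjoint_compl_left (a := range f)).mono_right (image_subset_range _ _)

theorem mk_le_compl_range_of_injective_sum {f : X → X} {g : X ⊕ X → X} (hg : Injective g)
    (h : ∀ x, f x ∈ range (g ∘ Sum.inl)) : #X ≤ #((range f)ᶜ : Set X) := by
  refine mk_le_of_injective (f := fun x => ⟨g (Sum.inr x), ?_⟩) ?_
  · rintro ⟨y, hy⟩
    obtain ⟨z, hz⟩ := h y
    exact Sum.inl_ne_inr (hg (hz.trans hy))
  · intro x y hxy
    exact Sum.inr_injective (hg (congrArg Subtype.val hxy))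

theorem exists_injective_choice (B : D → Set X) (h : ∀ d, #D ≤ #(B d)) :
    ∃ e : D → X, Injective e ∧ ∀ d, e d ∈ B d := by
  obtain ⟨_, _, ho⟩ := exists_ord_eq_type_lt D
  have key : ∀ (d : D) (p : Iio d → X), ∃ x ∈ B d, x ∉ range p := by
    intro d p
    by_contra! hc
    have h₁ : #(B d) ≤ #(range p) := mk_le_mk_of_subset hc
    exact ((h d).trans (h₁.trans mk_range_le)).not_gt (mk_Iio_lt d ho)
  choose F hF hF' using key
  let e : D → X := WellFoundedLT.fix fun d ih => F d fun z => ih z z.2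
  have he : ∀ d, e d = F d fun z => e z := fun d => WellFoundedLT.fix_eq _ d
  have hlt : ∀ a b, a < b → e a ≠ e b := fun a b hab hne =>
    hF' b (fun z => e z) ⟨⟨a, hab⟩, hne.trans (he b)⟩
  refine ⟨e, fun a b hab => ?_, fun d => by rw [he]; exact hF _ _⟩
  by_contra hne
  rcases lt_or_gt_of_ne hne with h' | h'
  exacts [hlt _ _ h' hab, hlt _ _ h' hab.symm]

theorem exists_cofinal_family_of_singular [Infinite X] (hX : ¬ (#X).IsRegular) :
    ∃ (I : Type u) (c : I → Cardinal.{u}), #I < #X ∧ (∀ i, c i < #X) ∧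
      ∀ ν < #X, ∃ i, ν ≤ c i := by
  obtain ⟨_, _, ho⟩ := exists_ord_eq_type_lt X
  obtain ⟨s, hs, hcard⟩ := Order.exists_cof_eq X
  refine ⟨s, fun i => #(Iio (i : X)), ?_, fun i => mk_Iio_lt _ ho, fun ν hν => ?_⟩
  · rw [hcard, ← Ordinal.cof_type, ← ho]
    by_contra! hc
    exact hX ⟨aleph0_le_mk X, hc⟩
  · have hlt : ν.ord < Ordinal.type ((· < ·) : X → X → Prop) := by
      rw [← ho]; exact ord_lt_ord.2 hν
    obtain ⟨z, hz⟩ := Ordinal.typein_surj _ hlt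
    obtain ⟨i, hi, hzi⟩ := hs z
    refine ⟨⟨i, hi⟩, ?_⟩
    have : #(Iio z) = ν := by
      rw [← card_ord ν, ← hz]; rfl
    rw [← this]
    exact mk_le_mk_of_subset (Iio_subset_Iio hzi)

end Permutations

section Submonoids

variable {X : Type u} {ξ η : Cardinal.{u}}

theorem add_lt_of_eq_one_or_aleph0_le (hξ : ξ = 1 ∨ ℵ₀ ≤ ξ) {a b : Cardinal.{u}}
    (ha : a < ξ) (hb : b < ξ) : a + b < ξ := by
  rcases hξ with rfl | hξ
  · rw [Cardinal.lt_one_iff] at *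
    simp [ha, hb]
  · exact add_lt_of_lt hξ ha hb

theorem pos_of_eq_one_or_aleph0_le (hξ : ξ = 1 ∨ ℵ₀ ≤ ξ) : 0 < ξ := by
  rcases hξ with rfl | hξ
  · exact one_pos
  · exact aleph0_pos.trans_le hξ

theorem xiInjective_of_injective {f : X → X} (hξ : 0 < ξ) (hf : Injective f) :
    XiInjective ξ f :=
  ⟨∅, by simpa using hξ, hf.injOn⟩

theorem xiSurjective_of_surjective {f : X → X} (hξ : 0 < ξ) (hf : Surjective f) :
    XiSurjective ξ f := by
  unfold XiSurjective
  rw [hf.range_eq]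
  simpa using hξ

theorem monG_comp_mem (hξ : ξ = 1 ∨ ℵ₀ ≤ ξ) {f g : X → X} (hf : f ∈ monG X ξ)
    (hg : g ∈ monG X ξ) : f ∘ g ∈ monG X ξ := by
  refine or_iff_not_imp_right.2 fun hs => ?_
  have hs : XiSurjective ξ (f ∘ g) := not_not.1 hs
  have hfs : XiSurjective ξ f :=
    (mk_le_mk_of_subset (compl_subset_compl.2 (range_comp_subset_range g f))).trans_lt hs
  obtain ⟨Y, hY, hYf⟩ := hf.resolve_right (not_not.2 hfs)
  have hgs : XiSurjective ξ g := by
    have hsub : ((range g)ᶜ : Set X) ⊆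
        Y ∪ {z | z ∉ Y ∧ f z ∈ (range (f ∘ g))ᶜ ∪ f '' Y} := by
      intro z hz
      by_cases hzY : z ∈ Y
      · exact Or.inl hzY
      refine Or.inr ⟨hzY, ?_⟩
      by_contra hc
      obtain ⟨⟨x, hx⟩, h₂⟩ : f z ∈ range (f ∘ g) ∧ f z ∉ f '' Y := by simpa using hc
      have hgx : g x ∉ Y := fun h => h₂ ⟨g x, h, hx⟩
      exact hz ⟨x, hYf hgx hzY hx⟩
    have hinj : #{z | z ∉ Y ∧ f z ∈ (range (f ∘ g))ᶜ ∪ f '' Y} ≤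
        #((range (f ∘ g))ᶜ ∪ f '' Y : Set X) :=
      mk_le_of_injective (f := fun z => ⟨f z, z.2.2⟩) fun a b hab =>
        Subtype.ext (hYf a.2.1 b.2.1 (congrArg Subtype.val hab))
    refine ((mk_le_mk_of_subset hsub).trans (mk_union_le _ _)).trans_lt
      (add_lt_of_eq_one_or_aleph0_le hξ hY (hinj.trans_lt ((mk_union_le _ _).trans_lt ?_)))
    exact add_lt_of_eq_one_or_aleph0_le hξ hs (mk_image_le.trans_lt hY)
  obtain ⟨Z, hZ, hZg⟩ := hg.resolve_right (not_not.2 hgs)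
  refine ⟨Z ∪ {z | z ∉ Z ∧ g z ∈ Y}, (mk_union_le _ _).trans_lt
    (add_lt_of_eq_one_or_aleph0_le hξ hZ (lt_of_le_of_lt ?_ hY)), ?_⟩
  · exact mk_le_of_injective (f := fun z => ⟨g z, z.2.2⟩) fun a b hab =>
        Subtype.ext (hZg a.2.1 b.2.1 (congrArg Subtype.val hab))
  · intro a ha b hb hab
    simp only [mem_compl_iff, mem_union, mem_ofPred_eq, not_or, not_and] at ha hb
    exact hZg ha.1 hb.1 (hYf (ha.2 ha.1) (hb.2 hb.1) hab)

theorem monM_comp_mem (hξ : ξ = 1 ∨ ℵ₀ ≤ ξ) {f g : X → X} (hf : f ∈ monM X ξ)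
    (hg : g ∈ monM X ξ) : f ∘ g ∈ monM X ξ := by
  refine or_iff_not_imp_right.2 fun hs => ?_
  obtain ⟨Y, hY, hYi⟩ : XiInjective ξ (f ∘ g) := not_not.1 hs
  have hgs : XiSurjective ξ g := hg.resolve_right <| not_not.2
    ⟨Y, hY, fun a ha b hb hab => hYi ha hb (congrArg f hab)⟩
  have hfs : XiSurjective ξ f := by
    refine hf.resolve_right (not_not.2 ⟨(range g)ᶜ ∪ g '' Y, (mk_union_le _ _).trans_lt
      (add_lt_of_eq_one_or_aleph0_le hξ hgs (mk_image_le.trans_lt hY)), ?_⟩)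
    intro a ha b hb hab
    obtain ⟨⟨x, rfl⟩, hx⟩ : a ∈ range g ∧ a ∉ g '' Y := by simpa using ha
    obtain ⟨⟨y, rfl⟩, hy⟩ : b ∈ range g ∧ b ∉ g '' Y := by simpa using hb
    exact congrArg g (hYi (fun h => hx ⟨x, h, rfl⟩) (fun h => hy ⟨y, h, rfl⟩) hab)
  have hsub : ((range (f ∘ g))ᶜ : Set X) ⊆ (range f)ᶜ ∪ f '' (range g)ᶜ := by
    intro z hz
    by_cases hzf : z ∈ range f
    · obtain ⟨y, rfl⟩ := hzf
      exact Or.inr ⟨y, fun ⟨x, hx⟩ => hz ⟨x, congrArg f hx⟩, rfl⟩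
    · exact Or.inl hzf
  exact ((mk_le_mk_of_subset hsub).trans (mk_union_le _ _)).trans_lt
    (add_lt_of_eq_one_or_aleph0_le hξ hfs (mk_image_le.trans_lt hgs))

theorem monA'_comp_mem (hX : ℵ₀ < #X) {f g : X → X} (hf : f ∈ monA' X)
    (hg : g ∈ monA' X) : f ∘ g ∈ monA' X := by
  obtain ⟨ξ₁, h₁, hf⟩ := hf
  obtain ⟨ξ₂, h₂, hg⟩ := hg
  have hinf : ℵ₀ ≤ max (max ξ₁ ξ₂) ℵ₀ := le_max_right _ _
  refine ⟨max (max ξ₁ ξ₂) ℵ₀, max_lt (max_lt h₁ h₂) hX, ?_⟩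
  refine lt_of_le_of_lt ((mk_le_mk_of_subset ?_).trans (mk_union_le
    {x : X | ¬ #(f ⁻¹' {x}) ≤ ξ₁} (f '' {x : X | ¬ #(g ⁻¹' {x}) ≤ ξ₂})))
    (add_lt_of_lt hX.le hf (mk_image_le.trans_lt hg))
  intro x hx
  by_contra hc
  simp only [mem_union, mem_ofPred_eq, not_or, not_not, mem_image, not_exists, not_and] at hc
  refine hx ?_
  have hpre : (f ∘ g) ⁻¹' {x} = ⋃ y ∈ f ⁻¹' {x}, g ⁻¹' {y} := by ext; simp
  rw [hpre]
  refine (mk_biUnion_le _ _).trans ?_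
  rw [← mul_eq_self hinf]
  refine mul_le_mul' (hc.1.trans ((le_max_left _ _).trans (le_max_left _ _)))
    (ciSup_le' fun y => le_trans ?_ ((le_max_right _ _).trans (le_max_left _ _)))
  by_contra h
  exact hc.2 y h y.2

theorem exists_submonoid_monG (hξ : ξ = 1 ∨ ℵ₀ ≤ ξ) :
    ∃ C : Submonoid (Function.End X), (C : Set (Function.End X)) = monG X ξ :=
  ⟨{ carrier := monG X ξ
     mul_mem' := monG_comp_mem hξ
     one_mem' := Or.inl
      (xiInjective_of_injective (pos_of_eq_one_or_aleph0_le hξ) injective_id) }, rfl⟩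

theorem exists_submonoid_monM (hξ : ξ = 1 ∨ ℵ₀ ≤ ξ) :
    ∃ C : Submonoid (Function.End X), (C : Set (Function.End X)) = monM X ξ :=
  ⟨{ carrier := monM X ξ
     mul_mem' := monM_comp_mem hξ
     one_mem' := Or.inl
      (xiSurjective_of_surjective (pos_of_eq_one_or_aleph0_le hξ) surjective_id) }, rfl⟩

theorem mem_monA'_of_fiber_le {f : X → X} (hξ : ξ < #X) (hf : ∀ x, #(f ⁻¹' {x}) ≤ ξ) :
    f ∈ monA' X := by
  refine ⟨ξ, hξ, ?_⟩
  simpa [hf] using hξ.bot_lt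

theorem exists_submonoid_monA' (hX : ℵ₀ < #X) :
    ∃ C : Submonoid (Function.End X), (C : Set (Function.End X)) = monA' X :=
  ⟨{ carrier := monA' X
     mul_mem' := monA'_comp_mem hX
     one_mem' := mem_monA'_of_fiber_le (one_lt_aleph0.trans hX) fun x => by
      change #(id ⁻¹' {x}) ≤ 1
      simp }, rfl⟩

theorem not_mem_monA'_of_large_fibers {D : Type u} {f : X → X} {k : D → X} (hD : #X ≤ #D)
    (hk : Injective k) (h : ∀ z, #X ≤ #(f ⁻¹' {k z})) : f ∉ monA' X := by
  rintro ⟨ξ, hξ, hf⟩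
  refine hf.not_ge (hD.trans ?_)
  rw [← mk_range_eq k hk]
  refine mk_le_mk_of_subset ?_
  rintro _ ⟨z, rfl⟩
  exact not_le.2 (hξ.trans_le (h z))

theorem not_mem_monG {f : X → X} (hs : XiSurjective ξ f) (hi : ∀ Y : Set X, InjOn f Yᶜ → ξ ≤ #Y) :
    f ∉ monG X ξ := by
  rintro (⟨Y, hY, hYf⟩ | h)
  exacts [hY.not_ge (hi Y hYf), h hs]

theorem not_mem_monM {f : X → X} (hi : XiInjective ξ f) (hs : ξ ≤ #((range f)ᶜ : Set X)) :
    f ∉ monM X ξ := by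
  rintro (h | h)
  exacts [hs.not_gt h, h hi]

end Submonoids

section Examples

variable {X : Type u} [Infinite X] {ξ η : Cardinal.{u}}

theorem exists_set_sum_equiv (hξ : ξ ≤ #X) : ∃ T : Set X, #T = ξ ∧ Nonempty (X ⊕ T ≃ X) := by
  obtain ⟨T, rfl⟩ := le_mk_iff_exists_set.1 hξ
  refine ⟨T, rfl, Cardinal.eq.1 ?_⟩
  rw [mk_sum, lift_id, lift_id, add_eq_left (aleph0_le_mk X) hξ]

theorem exists_injective_mk_compl_range_eq (hξ : ξ ≤ #X) :
    ∃ i : X → X, Injective i ∧ #((range i)ᶜ : Set X) = ξ := by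
  obtain ⟨T, rfl, ⟨e⟩⟩ := exists_set_sum_equiv hξ
  refine ⟨e ∘ Sum.inl, e.injective.comp Sum.inl_injective, ?_⟩
  have h : (range (e ∘ Sum.inl))ᶜ = range (e ∘ Sum.inr) := by
    ext x
    obtain ⟨y, rfl⟩ := e.surjective x
    cases y <;> simp
  rw [h, mk_range_eq _ (e.injective.comp Sum.inr_injective)]

theorem exists_surjective_collapse (hξ : ξ ≤ #X) :
    ∃ d : X → X, Surjective d ∧ (∀ y, #(d ⁻¹' {y}) ≤ 2) ∧
      (∃ Y : Set X, #Y ≤ ξ ∧ InjOn d Yᶜ) ∧ ∀ Y : Set X, InjOn d Yᶜ → ξ ≤ #Y := by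
  classical
  obtain ⟨T, rfl, ⟨e⟩⟩ := exists_set_sum_equiv hξ
  let d : X → X := fun x => Sum.elim id Subtype.val (e.symm x)
  have hl : ∀ x, d (e (Sum.inl x)) = x := fun x => by simp [d]
  have hr : ∀ t, d (e (Sum.inr t)) = t := fun x => by simp [d]
  refine ⟨d, fun x => ⟨_, hl x⟩, fun y => ?_, ⟨range (e ∘ Sum.inr), mk_range_le, ?_⟩,
    fun Y hY => ?_⟩
  · have : #(d ⁻¹' {y}) ≤ #(ULift.{u} Bool) := by
      refine mk_le_of_injective (f := fun x => ⟨(e.symm x).isLeft⟩) ?_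
      rintro ⟨a, ha⟩ ⟨b, hb⟩ hab
      obtain ⟨a, rfl⟩ := e.surjective a
      obtain ⟨b, rfl⟩ := e.surjective b
      have hd : d (e a) = d (e b) := ha.trans hb.symm
      rcases a with a | a <;> rcases b with b | b <;> simp_all
      exact Subtype.ext hd
    simpa using this
  · intro a ha b hb hab
    obtain ⟨a, rfl⟩ := e.surjective a
    obtain ⟨b, rfl⟩ := e.surjective b
    rcases a with a | a <;> rcases b with b | b <;> simp_all
  · have key : ∀ t : T, e (Sum.inl t) ∉ Y → e (Sum.inr t) ∈ Y := by
      intro t ht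
      by_contra hc
      simpa using hY ht hc ((hl _).trans (hr t).symm)
    refine mk_le_of_injective (f := fun t : T =>
      if h : e (Sum.inl t) ∈ Y then (⟨_, h⟩ : Y) else ⟨_, key t h⟩) fun a b hab => ?_
    have hd : ∀ t : T, d ((if h : e (Sum.inl t) ∈ Y then (⟨_, h⟩ : Y) else ⟨_, key t h⟩ : Y) : X)
        = t := by
      intro t
      split_ifs
      exacts [hl _, hr t]
    exact Subtype.ext ((hd a).symm.trans ((congrArg (fun y : Y => d y) hab).trans (hd b)))

theorem monA'_not_subset_monG (hξ : 0 < ξ) (hξX : ξ ≤ #X) : ¬ monA' X ⊆ monG X ξ := by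
  obtain ⟨d, hd, hd₂, -, hdi⟩ := exists_surjective_collapse (le_refl #X)
  exact fun h => not_mem_monG (xiSurjective_of_surjective hξ hd)
    (fun Y hY => hξX.trans (hdi Y hY))
    (h (mem_monA'_of_fiber_le (natCast_lt_aleph0.trans_le (aleph0_le_mk X)) hd₂))

theorem monA'_not_subset_monM (hξ : 0 < ξ) (hξX : ξ ≤ #X) : ¬ monA' X ⊆ monM X ξ := by
  obtain ⟨i, hi, hir⟩ := exists_injective_mk_compl_range_eq (le_refl #X)
  refine fun h => not_mem_monM (xiInjective_of_injective hξ hi) (hξX.trans_eq hir.symm) (h ?_)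
  refine mem_monA'_of_fiber_le (one_lt_aleph0.trans_le (aleph0_le_mk X)) fun x => ?_
  exact mk_le_one_iff_set_subsingleton.2 (subsingleton_singleton.preimage hi)

theorem exists_large_fibers : ∃ p : X → X, Surjective p ∧ ∀ y, #X ≤ #(p ⁻¹' {y}) := by
  obtain ⟨e⟩ : Nonempty (X × X ≃ X) := Cardinal.eq.1 (by simp)
  have hp : ∀ y z, (e.symm (e (y, z))).1 = y := by simp
  refine ⟨fun x => (e.symm x).1, fun y => ⟨e (y, y), hp y y⟩, fun y => ?_⟩
  exact mk_le_of_injective (f := fun z => ⟨e (y, z), hp y z⟩) fun a b hab => by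
    simpa using congrArg Subtype.val hab

theorem monG_not_subset_monA' (hξX : ξ ≤ #X) : ¬ monG X ξ ⊆ monA' X := by
  obtain ⟨i, hi, hir⟩ := exists_injective_mk_compl_range_eq (le_refl #X)
  obtain ⟨p, -, hp⟩ := exists_large_fibers (X := X)
  intro h
  refine not_mem_monA'_of_large_fibers (f := i ∘ p) le_rfl hi (fun z => ?_)
    (h (Or.inr (not_lt.2 (hξX.trans (hir.ge.trans (mk_le_mk_of_subset
      (compl_subset_compl.2 (range_comp_subset_range p i))))))))
  refine (hp z).trans (mk_le_mk_of_subset ?_)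
  rintro x rfl
  rfl

theorem monM_not_subset_monA' (hξ : 0 < ξ) : ¬ monM X ξ ⊆ monA' X := by
  obtain ⟨p, hps, hp⟩ := exists_large_fibers (X := X)
  exact fun h => not_mem_monA'_of_large_fibers le_rfl injective_id hp
    (h (Or.inl (xiSurjective_of_surjective hξ hps)))

theorem monG_not_subset_monM (hξ : 0 < ξ) (hη : 0 < η) (hηX : η ≤ #X) :
    ¬ monG X ξ ⊆ monM X η := by
  obtain ⟨i, hi, hir⟩ := exists_injective_mk_compl_range_eq (le_refl #X)
  exact fun h => not_mem_monM (xiInjective_of_injective hη hi) (hηX.trans_eq hir.symm)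
    (h (Or.inl (xiInjective_of_injective hξ hi)))

theorem monM_not_subset_monG (hξ : 0 < ξ) (hη : 0 < η) (hηX : η ≤ #X) :
    ¬ monM X ξ ⊆ monG X η := by
  obtain ⟨d, hd, -, -, hdi⟩ := exists_surjective_collapse (le_refl #X)
  exact fun h => not_mem_monG (xiSurjective_of_surjective hη hd)
    (fun Y hY => hηX.trans (hdi Y hY)) (h (Or.inl (xiSurjective_of_surjective hξ hd)))

theorem monG_not_subset_monG (hξX : ξ ≤ #X) (hη : 0 < η) (hηX : η ≤ #X) (hne : ξ ≠ η) :
    ¬ monG X ξ ⊆ monG X η := by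
  intro h
  rcases lt_or_gt_of_ne hne with hlt | hlt
  · obtain ⟨i, hi, hir⟩ := exists_injective_mk_compl_range_eq hξX
    obtain ⟨d, hd, -, -, hdi⟩ := exists_surjective_collapse (le_refl #X)
    have hr : #((range (i ∘ d))ᶜ : Set X) = ξ := by rw [hd.range_comp, hir]
    exact not_mem_monG (hr.trans_lt hlt) (fun Y hY => hηX.trans (hdi Y fun a ha b hb hab =>
      hY ha hb (congrArg i hab))) (h (Or.inr (not_lt.2 hr.ge)))
  · obtain ⟨d, hd, -, ⟨Y, hY, hYd⟩, hdi⟩ := exists_surjective_collapse hηX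
    exact not_mem_monG (xiSurjective_of_surjective hη hd) hdi
      (h (Or.inl ⟨Y, hY.trans_lt hlt, hYd⟩))

theorem monM_not_subset_monM (hξX : ξ ≤ #X) (hη : 0 < η) (hηX : η ≤ #X) (hne : ξ ≠ η) :
    ¬ monM X ξ ⊆ monM X η := by
  intro h
  rcases lt_or_gt_of_ne hne with hlt | hlt
  · obtain ⟨i, hi, hir⟩ := exists_injective_mk_compl_range_eq (le_refl #X)
    obtain ⟨d, hd, -, ⟨Y, hY, hYd⟩, hdi⟩ := exists_surjective_collapse hξX
    have hr : #((range (i ∘ d))ᶜ : Set X) = #X := by rw [hd.range_comp, hir]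
    refine not_mem_monM ⟨Y, hY.trans_lt hlt, fun a ha b hb hab => hYd ha hb (hi hab)⟩
      (hηX.trans_eq hr.symm) (h (Or.inr ?_))
    rintro ⟨Z, hZ, hZd⟩
    exact hZ.not_ge (hdi Z fun a ha b hb hab => hZd ha hb (congrArg i hab))
  · obtain ⟨i, hi, hir⟩ := exists_injective_mk_compl_range_eq hηX
    exact not_mem_monM (xiInjective_of_injective hη hi) hir.ge (h (Or.inl (hir.trans_lt hlt)))

end Examples

section Completeness

variable {X : Type u} [Infinite X] {M : Submonoid (Function.End X)}

theorem exists_injective_mem (hSM : permSubmonoid X ≤ M)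
    (hM : ∀ ξ : Cardinal.{u}, (ξ = 1 ∨ ℵ₀ ≤ ξ) → ξ ≤ #X →
      ¬ (M : Set (Function.End X)) ⊆ monM X ξ) (ξ : Cardinal.{u}) (hξ : ξ ≤ #X) :
    ∃ g : X → X, g ∈ M ∧ Injective g ∧ ξ ≤ #((range g)ᶜ : Set X) := by
  have step : ∀ ξ : Cardinal.{u}, (ξ = 1 ∨ ℵ₀ ≤ ξ) → ξ ≤ #X → ∃ f : X → X, f ∈ M ∧
      XiInjective ξ f ∧ ξ ≤ #((range f)ᶜ : Set X) := by
    intro ξ h hξ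
    obtain ⟨f, hf, hfM⟩ := Set.not_subset.1 (hM ξ h hξ)
    obtain ⟨h₁, h₂⟩ := not_or.1 hfM
    exact ⟨f, hf, not_not.1 h₂, not_lt.1 h₁⟩
  induction ξ using WellFoundedLT.induction with | ind ξ ih
  rcases lt_or_ge ξ ℵ₀ with hfin | hinf
  · obtain ⟨n, rfl⟩ := lt_aleph0.1 hfin
    clear ih hfin hξ
    obtain ⟨f, hf, ⟨Y, hY, hYf⟩, hfr⟩ := step 1 (Or.inl rfl) (one_le_aleph0.trans (aleph0_le_mk X))
    rw [Cardinal.lt_one_iff, mk_eq_zero_iff, isEmpty_coe_sort] at hY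
    rw [hY, compl_empty, injOn_univ] at hYf
    induction n with
    | zero => exact ⟨id, M.one_mem, injective_id, by simp⟩
    | succ n ih =>
      obtain ⟨g, hg, hgi, hgr⟩ := ih
      refine ⟨g ∘ f, M.mul_mem hg hf, hgi.comp hYf, ?_⟩
      rw [mk_compl_range_comp hgi, Nat.cast_succ]
      exact add_le_add hgr hfr
  · obtain ⟨f, hf, ⟨Y, hY, hYf⟩, hfr⟩ := step ξ (Or.inr hinf) hξ
    obtain ⟨g, hg, hgi, hgr⟩ := ih _ hY (hY.le.trans hξ)
    obtain ⟨π, hπ⟩ := exists_perm_mapsTo (hY.trans_le hξ) hgr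
    have hmem : ∀ x, π.symm (g x) ∈ Yᶜ := fun x hx => hπ _ hx ⟨x, by simp⟩
    refine ⟨f ∘ π.symm ∘ g, M.mul_mem hf (M.mul_mem (hSM π.symm.bijective) hg), ?_, ?_⟩
    · exact fun a b hab => hgi (π.symm.injective (hYf (hmem a) (hmem b) hab))
    · exact hfr.trans (mk_le_mk_of_subset (compl_subset_compl.2 (range_comp_subset_range _ f)))

theorem exists_surjective_mem (hSM : permSubmonoid X ≤ M)
    (hM : ∀ ξ : Cardinal.{u}, (ξ = 1 ∨ ℵ₀ ≤ ξ) → ξ ≤ #X →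
      ¬ (M : Set (Function.End X)) ⊆ monG X ξ) (ξ : Cardinal.{u}) (hξ : ξ ≤ #X) :
    ∃ g s : X → X, g ∈ M ∧ LeftInverse g s ∧ ξ ≤ #((range s)ᶜ : Set X) := by
  have step : ∀ ξ : Cardinal.{u}, (ξ = 1 ∨ ℵ₀ ≤ ξ) → ξ ≤ #X → ∃ f : X → X, f ∈ M ∧
      XiSurjective ξ f ∧ ∀ Y : Set X, InjOn f Yᶜ → ξ ≤ #Y := by
    intro ξ h hξ
    obtain ⟨f, hf, hfM⟩ := Set.not_subset.1 (hM ξ h hξ)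
    obtain ⟨h₁, h₂⟩ := not_or.1 hfM
    exact ⟨f, hf, not_not.1 h₂, fun Y hY => not_lt.1 fun hlt => h₁ ⟨Y, hlt, hY⟩⟩
  induction ξ using WellFoundedLT.induction with | ind ξ ih
  rcases lt_or_ge ξ ℵ₀ with hfin | hinf
  · obtain ⟨n, rfl⟩ := lt_aleph0.1 hfin
    clear ih hfin hξ
    obtain ⟨f, hf, hfs, hfi⟩ := step 1 (Or.inl rfl) (one_le_aleph0.trans (aleph0_le_mk X))
    unfold XiSurjective at hfs
    rw [Cardinal.lt_one_iff, mk_eq_zero_iff, isEmpty_coe_sort, compl_empty_iff,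
      range_eq_univ] at hfs
    induction n with
    | zero => exact ⟨id, id, M.one_mem, fun _ => rfl, by simp⟩
    | succ n ih =>
      obtain ⟨g, s, hg, hgs, hsr⟩ := ih
      have hfs' := rightInverse_surjInv hfs
      refine ⟨g ∘ f, surjInv hfs ∘ s, M.mul_mem hg hf, LeftInverse.comp hfs' hgs, ?_⟩
      rw [mk_compl_range_comp hfs'.injective, Nat.cast_succ, add_comm]
      refine add_le_add (hfi _ ?_) hsr
      rw [compl_compl]
      exact hfs'.rightInvOn_range.injOn
  · obtain ⟨f, hf, hfs, hfi⟩ := step ξ (Or.inr hinf) hξ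
    obtain ⟨g, s, hg, hgs, hsr⟩ := ih _ hfs (hfs.le.trans hξ)
    obtain ⟨π, hπ⟩ := exists_perm_mapsTo (hfs.trans_le hξ) hsr
    have hsurj : Surjective (g ∘ π ∘ f) := by
      intro x
      by_cases h : π.symm (s x) ∈ range f
      · obtain ⟨y, hy⟩ := h
        exact ⟨y, by simp [hy, hgs x]⟩
      · exact absurd ⟨x, by simp⟩ (hπ _ h)
    have hinv := rightInverse_surjInv hsurj
    refine ⟨g ∘ π ∘ f, surjInv hsurj, M.mul_mem hg (M.mul_mem (hSM π.bijective) hf), hinv,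
      hfi _ ?_⟩
    rw [compl_compl]
    exact fun a ha b hb hab => hinv.rightInvOn_range.injOn ha hb (congrArg (g ∘ π) hab)

theorem exists_large_fibers_mem (hX : ¬ (#X).IsRegular) (hSM : permSubmonoid X ≤ M)
    (hM : ¬ (M : Set (Function.End X)) ⊆ monA' X) :
    ∃ (h : X → X) (k : X ⊕ X → X), h ∈ M ∧ Injective k ∧ ∀ z, #X ≤ #(h ⁻¹' {k z}) := by
  obtain ⟨f, hf, hfA⟩ := Set.not_subset.1 hM
  have hbig : ∀ ξ < #X, #X ≤ #{x : X | ¬ #(f ⁻¹' {x}) ≤ ξ} := fun ξ hξ =>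
    not_lt.1 fun h => hfA ⟨ξ, hξ, h⟩
  have hadd : #X + #X = #X := add_eq_self (aleph0_le_mk X)
  obtain ⟨I, c, hI, hc, hcof⟩ := exists_cofinal_family_of_singular hX
  obtain ⟨i₀, -⟩ := hcof 0 (aleph0_pos.trans_le (aleph0_le_mk X))
  have hSum : #((X ⊕ X) ⊕ X) = #X := by simp [hadd]
  obtain ⟨q⟩ : #((X ⊕ X) ⊕ X) ≤ #{x : X | ¬ #(f ⁻¹' {x}) ≤ #I} := hSum.trans_le (hbig _ hI)
  have hD : #(((X ⊕ X) ⊕ X) × I) ≤ #X := by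
    rw [mk_prod, lift_id, lift_id, hSum]
    exact mul_le_of_le (aleph0_le_mk X) le_rfl hI.le
  obtain ⟨e, he, hec⟩ := exists_injective_choice
    (fun d : ((X ⊕ X) ⊕ X) × I => {x : X | ¬ #(f ⁻¹' {x}) ≤ c d.2})
    fun d => hD.trans (hbig _ (hc d.2))
  let t : ∀ z, I ↪ f ⁻¹' {(q z : X)} := fun z => Classical.choice (not_le.1 (q z).2).le
  let t' : ((X ⊕ X) ⊕ X) × I → X := fun d => t d.1 d.2
  have hft : ∀ d, f (t' d) = q d.1 := fun d => (t d.1 d.2).2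
  have ht' : Injective t' := by
    rintro ⟨z, i⟩ ⟨w, j⟩ h
    obtain rfl : z = w := q.injective (Subtype.ext
      ((hft (z, i)).symm.trans ((congrArg f h).trans (hft (w, j)))))
    exact Prod.ext rfl ((t z).injective (Subtype.ext h))
  let incl : (X ⊕ X) × I → ((X ⊕ X) ⊕ X) × I := fun d => (Sum.inl d.1, d.2)
  have hincl : Injective incl := fun a b hab => by
    simpa [incl, Prod.ext_iff] using hab
  have hco : ∀ u : ((X ⊕ X) ⊕ X) × I → X, Injective u →
      #((range (u ∘ incl))ᶜ : Set X) = #X := by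
    intro u hu
    refine le_antisymm (mk_set_le _) (mk_le_of_injective
      (f := fun x => ⟨u (Sum.inr x, i₀), ?_⟩) fun a b hab => ?_)
    · rintro ⟨d, hd⟩
      simpa [incl] using hu hd
    · simpa using hu (congrArg Subtype.val hab)
  obtain ⟨π, hπ⟩ := exists_perm_comp_eq (he.comp hincl) (ht'.comp hincl)
    ((hco e he).trans (hco t' ht').symm)
  refine ⟨f ∘ π ∘ f, fun z => q (Sum.inl z), M.mul_mem hf (M.mul_mem (hSM π.bijective) hf),
    Subtype.val_injective.comp (q.injective.comp Sum.inl_injective), fun z => ?_⟩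
  have hle : ∀ i, c i < #((f ∘ π ∘ f) ⁻¹' {(q (Sum.inl z) : X)}) := fun i =>
    (not_le.1 (hec (incl (z, i)))).trans_le <| mk_le_mk_of_subset fun x hx => by
      have hx : f x = e (incl (z, i)) := hx
      have := hπ (z, i)
      simp only [comp_apply] at this
      change f (π (f x)) = _
      rw [hx, this]
      exact hft _
  by_contra! hlt
  obtain ⟨i, hi⟩ := hcof _ hlt
  exact (hle i).not_ge hi

theorem eq_top_of_not_subset (hX : ¬ (#X).IsRegular) (hSM : permSubmonoid X ≤ M)
    (hA : ¬ (M : Set (Function.End X)) ⊆ monA' X)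
    (hG : ∀ ξ : Cardinal.{u}, (ξ = 1 ∨ ℵ₀ ≤ ξ) → ξ ≤ #X →
      ¬ (M : Set (Function.End X)) ⊆ monG X ξ)
    (hM : ∀ ξ : Cardinal.{u}, (ξ = 1 ∨ ℵ₀ ≤ ξ) → ξ ≤ #X →
      ¬ (M : Set (Function.End X)) ⊆ monM X ξ) : M = ⊤ := by
  obtain ⟨i, hi, hii, hir⟩ := exists_injective_mem hSM hM _ le_rfl
  obtain ⟨d, s, hd, hds, hsr⟩ := exists_surjective_mem hSM hG _ le_rfl
  obtain ⟨h, k, hh, hk, hkh⟩ := exists_large_fibers_mem hX hSM hA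
  have hfull : ∀ f : X → X, #X ≤ #((range f)ᶜ : Set X) → #((range f)ᶜ : Set X) = #X :=
    fun f => (mk_set_le _).antisymm
  rw [eq_top_iff]
  rintro (g : X → X) -
  let E : ∀ z, X ↪ h ⁻¹' {k z} := fun z => Classical.choice (hkh z)
  let x₀ : X := Classical.arbitrary X
  let j : X → X := fun x => E (Sum.inl (g x)) x
  have hhE : ∀ z x, h (E z x) = k z := fun z x => (E z x).2
  have hj : Injective j := by
    intro a b hab
    have hgab : g a = g b := Sum.inl_injective (hk
      ((hhE _ a).symm.trans ((congrArg h hab).trans (hhE _ b))))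
    have hE : ∀ z w, z = w → (E z a : X) = E w b → a = b := by
      rintro z _ rfl hz
      exact (E z).injective (Subtype.ext hz)
    exact hE _ _ (congrArg Sum.inl hgab) hab
  have hjr : #X ≤ #((range j)ᶜ : Set X) := by
    refine mk_le_of_injective (f := fun x => ⟨E (Sum.inr x) x₀, ?_⟩) fun a b hab => ?_
    · rintro ⟨y, hy⟩
      exact Sum.inl_ne_inr (hk ((hhE _ y).symm.trans ((congrArg h hy).trans (hhE _ x₀))))
    · exact Sum.inr_injective (hk ((hhE _ x₀).symm.trans
        ((congrArg h (congrArg Subtype.val hab)).trans (hhE _ x₀))))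
  obtain ⟨σ, hσ⟩ := exists_perm_comp_eq hii hj ((hfull i hir).trans (hfull j hjr).symm)
  have hkr : #X ≤ #((range (k ∘ Sum.inl))ᶜ : Set X) :=
    mk_le_compl_range_of_injective_sum hk fun x => ⟨x, rfl⟩
  obtain ⟨π, hπ⟩ := exists_perm_comp_eq (hk.comp Sum.inl_injective) hds.injective
    ((hfull _ hkr).trans (hfull s hsr).symm)
  have hg : g = d ∘ π ∘ h ∘ σ ∘ i := by
    funext x
    have h₁ := hπ (g x)
    simp only [comp_apply] at h₁ ⊢
    rw [hσ, hhE, h₁, hds]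
  rw [hg]
  exact M.mul_mem hd (M.mul_mem (hSM π.bijective) (M.mul_mem hh (M.mul_mem (hSM σ.bijective) hi)))

end Completeness

theorem Precomplete.eq_of_le {X : Type u} {M C : Submonoid (Function.End X)} (hM : Precomplete M)
    (hMC : M ≤ C) (hC : C ≠ ⊤) : M = C := by
  refine le_antisymm hMC fun f hf => ?_
  by_contra hfM
  refine hC (top_le_iff.1 ((hM.2 f hfM).ge.trans (Submonoid.closure_le.2 ?_)))
  exact Set.union_subset hMC (Set.singleton_subset_iff.2 hf)

theorem precomplete_of_forall_lt_eq_top {X : Type u} {C : Submonoid (Function.End X)} (hC : C ≠ ⊤)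
    (h : ∀ N : Submonoid (Function.End X), C < N → N = ⊤) : Precomplete C := by
  refine ⟨hC, fun f hf => h _ (SetLike.lt_iff_le_and_exists.2
    ⟨fun g hg => Submonoid.subset_closure (Or.inl hg), f, Submonoid.subset_closure (Or.inr rfl), hf⟩)⟩

/-- The sets of functions `A'`, `G_ξ` and `M_ξ`, where `ξ = 1` or `ℵ₀ ≤ ξ ≤ #X`. -/
def IsMaximalMonoidCarrier {X : Type u} (D : Set (Function.End X)) : Prop :=
  D = monA' X ∨ ∃ ξ : Cardinal.{u}, (ξ = 1 ∨ (ℵ₀ ≤ ξ ∧ ξ ≤ #X)) ∧ (D = monG X ξ ∨ D = monM X ξ)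

namespace IsMaximalMonoidCarrier

variable {X : Type u} {D D' : Set (Function.End X)}

theorem monA' : IsMaximalMonoidCarrier (monA' X) := Or.inl rfl

theorem monG {ξ : Cardinal.{u}} (h : ξ = 1 ∨ ℵ₀ ≤ ξ) (hξ : ξ ≤ #X) :
    IsMaximalMonoidCarrier (monG X ξ) :=
  Or.inr ⟨ξ, h.imp_right fun h => ⟨h, hξ⟩, Or.inl rfl⟩

theorem monM {ξ : Cardinal.{u}} (h : ξ = 1 ∨ ℵ₀ ≤ ξ) (hξ : ξ ≤ #X) :
    IsMaximalMonoidCarrier (monM X ξ) :=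
  Or.inr ⟨ξ, h.imp_right fun h => ⟨h, hξ⟩, Or.inr rfl⟩

theorem exists_submonoid (hX : ℵ₀ < #X) (hD : IsMaximalMonoidCarrier D) :
    ∃ C : Submonoid (Function.End X), (C : Set (Function.End X)) = D := by
  rcases hD with rfl | ⟨ξ, hξ, rfl | rfl⟩
  exacts [exists_submonoid_monA' hX, exists_submonoid_monG (hξ.imp_right And.left),
    exists_submonoid_monM (hξ.imp_right And.left)]

variable [Infinite X]

theorem bounds_of_eq_one_or {ξ : Cardinal.{u}} (h : ξ = 1 ∨ (ℵ₀ ≤ ξ ∧ ξ ≤ #X)) :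
    0 < ξ ∧ ξ ≤ #X := by
  rcases h with rfl | ⟨h₁, h₂⟩
  · exact ⟨one_pos, one_le_aleph0.trans (aleph0_le_mk X)⟩
  · exact ⟨aleph0_pos.trans_le h₁, h₂⟩

theorem eq_of_subset (hD : IsMaximalMonoidCarrier D) (hD' : IsMaximalMonoidCarrier D')
    (h : D ⊆ D') : D = D' := by
  rcases hD with rfl | ⟨ξ, hξ, hD⟩ <;> rcases hD' with rfl | ⟨η, hη, hD'⟩
  · rfl
  · obtain ⟨hη, hηX⟩ := bounds_of_eq_one_or hη
    rcases hD' with rfl | rfl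
    exacts [absurd h (monA'_not_subset_monG hη hηX), absurd h (monA'_not_subset_monM hη hηX)]
  · obtain ⟨hξ, hξX⟩ := bounds_of_eq_one_or hξ
    rcases hD with rfl | rfl
    exacts [absurd h (monG_not_subset_monA' hξX), absurd h (monM_not_subset_monA' hξ)]
  · obtain ⟨hξ, hξX⟩ := bounds_of_eq_one_or hξ
    obtain ⟨hη, hηX⟩ := bounds_of_eq_one_or hη
    rcases hD with rfl | rfl <;> rcases hD' with rfl | rfl
    · by_contra hne
      exact monG_not_subset_monG hξX hη hηX (fun heq => hne (heq ▸ rfl)) h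
    · exact absurd h (monG_not_subset_monM hξ hη hηX)
    · exact absurd h (monM_not_subset_monG hξ hη hηX)
    · by_contra hne
      exact monM_not_subset_monM hξX hη hηX (fun heq => hne (heq ▸ rfl)) h

theorem ne_univ (hD : IsMaximalMonoidCarrier D) : D ≠ Set.univ := by
  rintro rfl
  have h₁ : (1 : Cardinal.{u}) ≤ #X := one_le_aleph0.trans (aleph0_le_mk X)
  refine monA'_not_subset_monG one_pos h₁ (Eq.subset ?_)
  exact (monA'.eq_of_subset hD (subset_univ _)).trans
    ((monG (Or.inl rfl) h₁).eq_of_subset hD (subset_univ _)).symm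

theorem eq_top_of_forall_not_subset {M : Submonoid (Function.End X)} (hX : ¬ (#X).IsRegular)
    (hSM : permSubmonoid X ≤ M)
    (h : ∀ D, IsMaximalMonoidCarrier D → ¬ (M : Set (Function.End X)) ⊆ D) : M = ⊤ :=
  eq_top_of_not_subset hX hSM (h _ monA') (fun _ hξ hξX => h _ (monG hξ hξX))
    fun _ hξ hξX => h _ (monM hξ hξX)

end IsMaximalMonoidCarrier

end MaximalMonoids

/-- Theorem 1 (singular case): on an infinite set of singular cardinality `κ`, the precomplete
submonoids of the full transformation monoid containing all permutations are exactly
`A'`, and `G_ξ`, `M_ξ` for `ξ = 1` and for infinite cardinals `ℵ₀ ≤ ξ ≤ κ`. -/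
theorem precomplete_monoids_above_S_singular {X : Type u} [Infinite X] {κ : Cardinal.{u}}
    (hκ : #X = κ) (hsing : ¬κ.IsRegular)
    (M : Submonoid (Function.End X)) (hSM : permSubmonoid X ≤ M) :
    Precomplete M ↔
      ((M : Set (Function.End X)) = monA' X ∨
        ∃ ξ : Cardinal.{u}, (ξ = 1 ∨ (ℵ₀ ≤ ξ ∧ ξ ≤ κ)) ∧
          ((M : Set (Function.End X)) = monG X ξ ∨
            (M : Set (Function.End X)) = monM X ξ)) := by
  subst hκ
  have hX : ℵ₀ < #X := (aleph0_le_mk X).lt_of_ne fun h => hsing (h ▸ isRegular_aleph0)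
  change Precomplete M ↔ IsMaximalMonoidCarrier (M : Set (Function.End X))
  constructor
  · intro hM
    by_contra hMc
    refine hM.1 (IsMaximalMonoidCarrier.eq_top_of_forall_not_subset hsing hSM fun D hD hMD => ?_)
    obtain ⟨C, rfl⟩ := hD.exists_submonoid hX
    obtain rfl := hM.eq_of_le hMD fun hC => hD.ne_univ (hC ▸ Submonoid.coe_top)
    exact hMc hD
  · intro hM
    refine precomplete_of_forall_lt_eq_top (fun h => hM.ne_univ (h ▸ Submonoid.coe_top))
      fun N hN => ?_
    refine IsMaximalMonoidCarrier.eq_top_of_forall_not_subset hsing (hSM.trans hN.le)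
      fun D hD hND => ?_
    have hMN : (M : Set (Function.End X)) ⊆ N := hN.le
    exact hN.not_ge (hND.trans (hM.eq_of_subset hD (hMN.trans hND)).superset)
end

section
/- Let X be an infinite set of singular cardinality κ = ℵ_α, let λ = max(|α|, ℵ₀), and let G be a precomplete submonoid of O^(1) containing all permutations with G ≠ A'. Then there is an order embedding of the power set of 2^λ into the interval [S, G] of submonoids of O^(1); in particular |[S, G]| = 2^(2^λ). -/
open Cardinal

universe u

/-- A family of at most `κ` sets of cardinality at least `κ` has an injective choice function. -/
theorem exists_injective_choice_s5 {ι X : Type u} (Y : ι → Set X) (hY : ∀ i, #ι ≤ #(Y i)) :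
    ∃ y : ι → X, Function.Injective y ∧ ∀ i, y i ∈ Y i := by
  obtain ⟨r, wo, hr⟩ := Cardinal.exists_ord_eq ι
  have key : ∀ i (g : ∀ j, r j i → X), ∃ z ∈ Y i, ∀ j h, g j h ≠ z := by
    intro i g
    by_contra! hcon
    have hsub : Y i ⊆ Set.range (fun j : {j // r j i} => g j.1 j.2) := by
      intro z hz
      obtain ⟨j, h, hj⟩ := hcon z hz
      exact ⟨⟨j, h⟩, hj⟩
    have h1 : #(Y i) ≤ #{j // r j i} := (mk_le_mk_of_subset hsub).trans mk_range_le
    have h2 : #{j // r j i} < #ι := Cardinal.card_typein_lt i hr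
    exact absurd (hY i) (not_le.2 (h1.trans_lt h2))
  choose F hF hF' using key
  have wf : WellFounded r := wo.wf
  let y : ι → X := wf.fix F
  have hy : ∀ i, y i = F i (fun j _ => y j) := fun i => wf.fix_eq F i
  have hne : ∀ i j, r j i → y j ≠ y i := by
    intro i j h
    rw [hy i]
    exact hF' i (fun j _ => y j) j h
  refine ⟨y, fun i j hij => ?_, fun i => by rw [hy i]; exact hF _ _⟩
  rcases trichotomous_of r i j with h | h | h
  · exact absurd hij (hne j i h)
  · exact h
  · exact absurd hij.symm (hne i j h)

theorem mk_sum_self {X : Type u} [Infinite X] : #(X ⊕ X) = #X := by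
  simp [Cardinal.add_eq_self (aleph0_le_mk X)]

/-- A partial injection whose range has complement of full cardinality extends to a total one. -/
theorem exists_injective_extension {T X : Type u} [Infinite X] (p q : T → X)
    (hp : Function.Injective p) (hq : Function.Injective q)
    (hc : #((Set.range q)ᶜ : Set X) = #X) :
    ∃ a : X → X, Function.Injective a ∧ #((Set.range a)ᶜ : Set X) = #X ∧
      ∀ t, a (p t) = q t := by
  classical
  obtain ⟨e⟩ := Cardinal.eq.1 ((mk_sum_self (X := X)).trans hc.symm)
  let a : X → X := fun x => if h : ∃ t, p t = x then q h.choose else e (Sum.inl x)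
  have ha1 : ∀ t, a (p t) = q t := by
    intro t
    have h : ∃ s, p s = p t := ⟨t, rfl⟩
    have h' : h.choose = t := hp h.choose_spec
    simp only [a, dif_pos h, h']
  have ha2 : ∀ x, (¬ ∃ t, p t = x) → a x = e (Sum.inl x) := fun x h => by simp only [a, dif_neg h]
  have hqe : ∀ t z, q t ≠ e z := fun t z h => (e z).2 ⟨t, h⟩
  refine ⟨a, fun x x' hxx => ?_, le_antisymm (mk_set_le _) ?_, ha1⟩
  · by_cases h : ∃ t, p t = x <;> by_cases h' : ∃ t, p t = x'
    · obtain ⟨t, rfl⟩ := h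
      obtain ⟨t', rfl⟩ := h'
      rw [ha1, ha1] at hxx
      rw [hq hxx]
    · obtain ⟨t, rfl⟩ := h
      rw [ha1, ha2 _ h'] at hxx
      exact absurd hxx (hqe _ _)
    · obtain ⟨t', rfl⟩ := h'
      rw [ha1, ha2 _ h] at hxx
      exact absurd hxx.symm (hqe _ _)
    · rw [ha2 _ h, ha2 _ h'] at hxx
      exact Sum.inl_injective (e.injective (Subtype.ext hxx))
  · have hmem : ∀ x, ((e (Sum.inr x) : X)) ∈ (Set.range a)ᶜ := by
      rintro x ⟨z, hz⟩
      by_cases h : ∃ t, p t = z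
      · obtain ⟨t, rfl⟩ := h
        rw [ha1] at hz
        exact hqe _ _ hz
      · rw [ha2 _ h] at hz
        exact Sum.inl_ne_inr (e.injective (Subtype.ext hz))
    refine mk_le_of_injective (f := fun x => (⟨_, hmem x⟩ : ((Set.range a)ᶜ : Set X))) ?_
    intro x x' h
    have hval : (e (Sum.inr x) : X) = e (Sum.inr x') := Subtype.mk.inj h
    exact Sum.inr_injective (e.injective (Subtype.ext hval))

/-- Two injections whose ranges have equinumerous complements differ by a permutation. -/
theorem exists_perm_comp_eq_s5 {X : Type u} {i j : X → X} (hi : Function.Injective i)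
    (hj : Function.Injective j)
    (h : #((Set.range i)ᶜ : Set X) = #((Set.range j)ᶜ : Set X)) :
    ∃ σ : X ≃ X, ∀ x, σ (i x) = j x := by
  let f : Set.range i ↪ X :=
    (Equiv.ofInjective i hi).symm.toEmbedding.trans ⟨j, hj⟩
  have hf : ∀ x, f ⟨i x, ⟨x, rfl⟩⟩ = j x := fun x => by
    change j ((Equiv.ofInjective i hi).symm ⟨i x, ⟨x, rfl⟩⟩) = j x
    rw [Equiv.ofInjective_symm_apply]
  have hr : Set.range f = Set.range j := by
    ext z
    constructor
    · rintro ⟨⟨_, x, rfl⟩, rfl⟩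
      exact ⟨x, (hf x).symm⟩
    · rintro ⟨x, rfl⟩
      exact ⟨_, hf x⟩
  obtain ⟨g, hg⟩ := Cardinal.extend_function f (by rw [hr]; exact Cardinal.eq.1 h)
  exact ⟨g, fun x => by rw [← hf x]; exact hg ⟨i x, ⟨x, rfl⟩⟩⟩

/-- A set of singular cardinality is a union of fewer than `κ` sets of cardinality less
than `κ`. -/
theorem exists_small_partition {X : Type u} [Infinite X] (hs : ¬ (#X).IsRegular) :
    ∃ (I : Type u) (idx : X → I), #I < #X ∧ ∀ i, #(idx ⁻¹' {i}) < #X := by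
  have hcof : (#X).ord.cof < #X := by
    by_contra! h
    exact hs ⟨aleph0_le_mk X, h⟩
  obtain ⟨s, hs, hcard⟩ := Order.exists_cof_eq (#X).ord.ToType
  obtain ⟨e⟩ := Cardinal.eq.1 (show #X = #(#X).ord.ToType by simp)
  choose g hg hge using fun x : X => hs (e x)
  refine ⟨s, fun x => ⟨g x, hg x⟩, ?_, fun i => ?_⟩
  · rw [hcard, Ordinal.cof_toType]
    exact hcof
  · have hlt : #(Set.Iic i.1) < #(#X).ord.ToType :=
      mk_Iic_lt i.1 (by simp) (by simp)
    rw [Cardinal.mk_ord_toType] at hlt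
    refine lt_of_le_of_lt ?_ hlt
    refine mk_le_of_injective (f := fun x => (⟨e x.1, ?_⟩ : Set.Iic i.1)) ?_
    · have := hge x.1
      have h2 : g x.1 = i.1 := congrArg Subtype.val x.2
      rw [← h2]
      exact this
    · intro x y hxy
      exact Subtype.ext (e.injective (congrArg Subtype.val hxy))

theorem mem_closure_union_iff_exists {M : Type u} [Monoid M] {N : Submonoid M} {F : Set M} {x : M}
    (hx : x ∈ Submonoid.closure ((N : Set M) ∪ F)) :
    x ∈ N ∨ ∃ g, ∃ f ∈ F, ∃ k ∈ N, x = g * f * k := by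
  induction hx using Submonoid.closure_induction with
  | mem y hy =>
    rcases hy with hy | hy
    · exact Or.inl hy
    · exact Or.inr ⟨1, y, hy, 1, N.one_mem, by simp⟩
  | one => exact Or.inl N.one_mem
  | mul a b _ _ ha hb =>
    rcases hb with hb | ⟨g, f, hf, k, hk, rfl⟩
    · rcases ha with ha | ⟨g, f, hf, k, hk, rfl⟩
      · exact Or.inl (N.mul_mem ha hb)
      · exact Or.inr ⟨g, f, hf, k * b, N.mul_mem hk hb, by simp [mul_assoc]⟩
    · exact Or.inr ⟨a * g, f, hf, k, hk, by simp [mul_assoc]⟩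

/-- `A'` as a submonoid. -/
def submonoidA' (X : Type u) [Infinite X] : Submonoid (Function.End X) where
  carrier := monA' X
  one_mem' := by
    refine ⟨1, one_lt_aleph0.trans_le (aleph0_le_mk X), ?_⟩
    have : {x : X | ¬ #((1 : Function.End X) ⁻¹' {x}) ≤ 1} = ∅ := by
      ext x
      simp [Function.End.one_def]
    rw [this]
    simpa using (aleph0_pos.trans_le (aleph0_le_mk X))
  mul_mem' := by
    rintro f g ⟨ξ, hξ, hf⟩ ⟨η, hη, hg⟩
    have hω := aleph0_le_mk X
    refine ⟨ξ * η, mul_lt_of_lt hω hξ hη, ?_⟩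
    have hsub : {x : X | ¬ #((f * g) ⁻¹' {x}) ≤ ξ * η} ⊆
        {x | ¬ #(f ⁻¹' {x}) ≤ ξ} ∪ f '' {x | ¬ #(g ⁻¹' {x}) ≤ η} := by
      intro y hy
      by_contra hcon
      have h1 : #(f ⁻¹' {y}) ≤ ξ := by
        by_contra h
        exact hcon (Or.inl h)
      have h2 : ∀ x ∈ f ⁻¹' {y}, #(g ⁻¹' {x}) ≤ η := by
        intro x hx
        by_contra h
        exact hcon (Or.inr ⟨x, h, hx⟩)
      have hcov : (f * g) ⁻¹' {y} ⊆ ⋃ x ∈ f ⁻¹' {y}, g ⁻¹' {x} := fun z hz =>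
        Set.mem_biUnion (x := g z) hz rfl
      exact hy ((mk_le_mk_of_subset hcov).trans ((mk_biUnion_le _ _).trans
        (mul_le_mul' h1 (ciSup_le' fun x => h2 x.1 x.2))))
    exact (mk_le_mk_of_subset hsub).trans_lt ((mk_union_le _ _).trans_lt
      (add_lt_of_lt hω hf (mk_image_le.trans_lt hg)))

theorem exists_notMem_monA' (X : Type u) [Infinite X] : ∃ f : Function.End X, f ∉ monA' X := by
  obtain ⟨e⟩ := Cardinal.eq.1 (show #(X × X) = #X by simp)
  refine ⟨fun x => (e.symm x).1, ?_⟩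
  rintro ⟨ξ, hξ, h⟩
  refine h.ne ?_
  have : {x : X | ¬ #((fun x => (e.symm x).1) ⁻¹' {x}) ≤ ξ} = Set.univ := by
    ext x
    refine ⟨fun _ => trivial, fun _ => not_le.2 ?_⟩
    refine hξ.trans_le (mk_le_of_injective (f := fun z => (⟨e (x, z), by simp⟩ :
      ((fun x => (e.symm x).1) ⁻¹' {x} : Set X))) ?_)
    intro z z' hz
    simpa using hz
  rw [this, mk_univ]

theorem exists_mem_notMem_monA' {X : Type u} [Infinite X] {G : Submonoid (Function.End X)}
    (hG : Precomplete G) (hGA : (G : Set (Function.End X)) ≠ monA' X) :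
    ∃ h ∈ G, h ∉ monA' X := by
  by_contra! hcon
  have hle : G ≤ submonoidA' X := hcon
  obtain ⟨f, hf, hfG⟩ : ∃ f ∈ submonoidA' X, f ∉ G := by
    by_contra! h2
    exact hGA (congrArg SetLike.coe (le_antisymm hle h2))
  have htop := hG.2 f hfG
  have : (⊤ : Submonoid (Function.End X)) ≤ submonoidA' X := by
    rw [← htop, Submonoid.closure_le]
    exact Set.union_subset hle (Set.singleton_subset_iff.2 hf)
  obtain ⟨g, hg⟩ := exists_notMem_monA' X
  exact hg (this (Submonoid.mem_top g))

/-- If `κ` is singular and `h ∉ A'`, then the composite of `h`, an injection and `h` collapses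
arbitrarily prescribed fibers: it can realize the first projection from `X × X`. -/
theorem exists_projection_of_notMem_monA' {X : Type u} [Infinite X] (hs : ¬ (#X).IsRegular)
    {h : X → X} (hh : h ∉ monA' X) :
    ∃ (a : Function.End X) (c : X × X → X) (d : X → X), Function.Injective a ∧
      #((Set.range a)ᶜ : Set X) = #X ∧ Function.Injective c ∧ Function.Injective d ∧
      ∀ x z, h (a (h (c (x, z)))) = d x := by
  have hω := aleph0_le_mk X
  obtain ⟨I, idx, hI, hidx⟩ := exists_small_partition hs
  have hbig : ∀ ξ : Cardinal.{u}, ξ < #X → #X ≤ #({x : X | ¬ #(h ⁻¹' {x}) ≤ ξ} : Set X) := by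
    intro ξ hξ
    by_contra hlt
    exact hh ⟨ξ, hξ, not_le.1 hlt⟩
  have hXI : #(X × I) ≤ #X := by
    rw [mk_prod, lift_id, lift_id]
    exact mul_le_of_le hω le_rfl hI.le
  obtain ⟨y, hy, hyY⟩ := exists_injective_choice_s5
    (fun p : X × I => {x : X | ¬ #(h ⁻¹' {x}) ≤ #(idx ⁻¹' {p.2})})
    (fun p => hXI.trans (hbig _ (hidx p.2)))
  obtain ⟨w, hw, hwY⟩ := exists_injective_choice_s5
    (fun _ : X ⊕ X => {x : X | ¬ #(h ⁻¹' {x}) ≤ #I})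
    (fun _ => mk_sum_self.le.trans (hbig _ hI))
  have hs' : ∀ p : X × I, ∃ s : X → X, Set.InjOn s (idx ⁻¹' {p.2}) ∧
      ∀ z, idx z = p.2 → h (s z) = y p := by
    classical
    intro p
    obtain ⟨s⟩ : Nonempty ((idx ⁻¹' {p.2} : Set X) ↪ (h ⁻¹' {y p} : Set X)) :=
      le_of_not_ge (hyY p)
    refine ⟨fun z => if hz : idx z = p.2 then s ⟨z, hz⟩ else z, fun z hz z' hz' hzz => ?_,
      fun z hz => ?_⟩
    · simp only [dif_pos (show idx z = p.2 from hz), dif_pos (show idx z' = p.2 from hz')] at hzz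
      exact congrArg Subtype.val (s.injective (Subtype.ext hzz))
    · simp only [dif_pos hz]
      exact (s ⟨z, hz⟩).2
  have ht' : ∀ x : X ⊕ X, ∃ t : I → X, Function.Injective t ∧ ∀ i, h (t i) = w x := by
    intro x
    obtain ⟨t⟩ : Nonempty (I ↪ (h ⁻¹' {w x} : Set X)) := le_of_not_ge (hwY x)
    exact ⟨fun i => t i, fun i j hij => t.injective (Subtype.ext hij), fun i => (t i).2⟩
  choose s hsinj hsfib using hs'
  choose t htinj htfib using ht'
  let q : X × I → X := fun p => t (Sum.inl p.1) p.2
  have hq : Function.Injective q := by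
    rintro ⟨x, i⟩ ⟨x', i'⟩ hqq
    have h1 : w (Sum.inl x) = w (Sum.inl x') := by
      rw [← htfib _ i, ← htfib _ i']
      exact congrArg h hqq
    obtain rfl : x = x' := Sum.inl_injective (hw h1)
    exact congrArg (Prod.mk x) (htinj (Sum.inl x) hqq)
  have hqc : #((Set.range q)ᶜ : Set X) = #X := by
    refine le_antisymm (mk_set_le _) ?_
    let i₀ : I := idx (Classical.arbitrary X)
    have hmem : ∀ x, (t (Sum.inr x) i₀) ∈ (Set.range q)ᶜ := by
      rintro x ⟨⟨x', i⟩, hx'⟩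
      have h1 : w (Sum.inl x') = w (Sum.inr x) := by
        rw [← htfib _ i, ← htfib _ i₀]
        exact congrArg h hx'
      exact Sum.inl_ne_inr (hw h1)
    refine mk_le_of_injective (f := fun x => (⟨_, hmem x⟩ : ((Set.range q)ᶜ : Set X))) ?_
    intro x x' hxx
    have h1 : w (Sum.inr x) = w (Sum.inr x') := by
      rw [← htfib _ i₀, ← htfib _ i₀]
      exact congrArg h (Subtype.mk.inj hxx)
    exact Sum.inr_injective (hw h1)
  obtain ⟨a, ha, hac, haq⟩ := exists_injective_extension y q hy hq hqc
  refine ⟨a, fun p => s (p.1, idx p.2) p.2, fun x => w (Sum.inl x), ha, hac, ?_,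
    hw.comp Sum.inl_injective, fun x z => ?_⟩
  · rintro ⟨x, z⟩ ⟨x', z'⟩ hxz
    have h1 : (x, idx z) = (x', idx z') := hy (by
      rw [← hsfib (x, idx z) z rfl, ← hsfib (x', idx z') z' rfl]
      exact congrArg h hxz)
    obtain ⟨rfl, h2⟩ := Prod.mk.inj h1
    have h3 : s (x, idx z') z = s (x, idx z') z' := by
      rw [← h2]
      simpa [← h2] using hxz
    rw [hsinj (x, idx z') (show idx z = idx z' from h2) rfl h3]
  · change h (a (h (s (x, idx z) z))) = w (Sum.inl x)
    rw [hsfib (x, idx z) z rfl, haq]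
    exact htfib _ _

/-- A submonoid containing the permutations, a function outside `A'` and an injection with
co-range of full cardinality contains every function with co-range of full cardinality. -/
theorem mem_of_injective_mem {X : Type u} [Infinite X] (hs : ¬ (#X).IsRegular)
    {G : Submonoid (Function.End X)} (hSG : permSubmonoid X ≤ G) {h i : Function.End X}
    (hhG : h ∈ G) (hh : h ∉ monA' X) (hiG : i ∈ G) (hi : Function.Injective i)
    (hic : #((Set.range i)ᶜ : Set X) = #X) {f : Function.End X}
    (hf : #((Set.range f)ᶜ : Set X) = #X) : f ∈ G := by
  have hinj : ∀ j : Function.End X, Function.Injective j →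
      #((Set.range j)ᶜ : Set X) = #X → j ∈ G := by
    intro j hj hjc
    obtain ⟨σ, hσ⟩ := exists_perm_comp_eq_s5 hi hj (hic.trans hjc.symm)
    let σ' : Function.End X := fun x => σ x
    have hσ' : σ' ∈ G := hSG σ.bijective
    have : j = σ' * i := funext fun x => (hσ x).symm
    rw [this]
    exact G.mul_mem hσ' hiG
  obtain ⟨a, c, d, ha, hac, hc, hd, hcd⟩ := exists_projection_of_notMem_monA' hs hh
  let b : Function.End X := fun x => c (f x, x)
  have hb : Function.Injective b := fun x x' hxx => (Prod.ext_iff.1 (hc hxx)).2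
  have hbc : #((Set.range b)ᶜ : Set X) = #X := by
    refine le_antisymm (mk_set_le _) ?_
    choose g hg using fun x => exists_ne (f x)
    have hmem : ∀ x, c (g x, x) ∈ (Set.range b)ᶜ := by
      rintro x ⟨x', hx'⟩
      have h1 := Prod.ext_iff.1 (hc hx')
      obtain rfl : x' = x := h1.2
      exact hg _ h1.1.symm
    refine mk_le_of_injective (f := fun x => (⟨_, hmem x⟩ : ((Set.range b)ᶜ : Set X))) ?_
    intro x x' hxx
    exact (Prod.ext_iff.1 (hc (Subtype.mk.inj hxx))).2
  obtain ⟨(j : Function.End X), hj, hjc, hjd⟩ := exists_injective_extension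
    (fun y : Set.range f => d y) (fun y : Set.range f => (y : X))
    (hd.comp Subtype.val_injective) Subtype.val_injective (by rw [Subtype.range_coe]; exact hf)
  have : f = j * (h * (a * (h * b))) := by
    funext x
    change f x = j (h (a (h (c (f x, x)))))
    rw [hcd]
    exact (hjd ⟨f x, x, rfl⟩).symm
  rw [this]
  exact G.mul_mem (hinj j hj hjc) (G.mul_mem hhG (G.mul_mem (hinj a ha hac)
    (G.mul_mem hhG (hinj b hb hbc))))

/-- Over a singular cardinal, every precomplete submonoid other than `A'` which contains the
permutations contains all functions with a fiber and a co-range of full cardinality. -/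
theorem mem_of_precomplete {X : Type u} [Infinite X] (hs : ¬ (#X).IsRegular)
    {G : Submonoid (Function.End X)} (hG : Precomplete G) (hSG : permSubmonoid X ≤ G)
    (hGA : (G : Set (Function.End X)) ≠ monA' X) {f : Function.End X}
    (hf : #((Set.range f)ᶜ : Set X) = #X) {y : X} (hy : #(f ⁻¹' {y}) = #X) : f ∈ G := by
  obtain ⟨h, hhG, hh⟩ := exists_mem_notMem_monA' hG hGA
  by_contra hfG
  obtain ⟨(i : Function.End X), hi, hic, -⟩ :=
    exists_injective_extension (X := X) (T := PEmpty.{u + 1}) PEmpty.elim PEmpty.elim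
      (fun x => x.elim) (fun x => x.elim)
      (by rw [Set.range_eq_empty, Set.compl_empty, mk_univ])
  have hmem : i ∈ Submonoid.closure ((G : Set (Function.End X)) ∪ {f}) := by
    rw [hG.2 f hfG]
    exact Submonoid.mem_top i
  rcases mem_closure_union_iff_exists hmem with hiG | ⟨g, f', hf', k, hk, hgk⟩
  · exact hfG (mem_of_injective_mem hs hSG hhG hh hiG hi hic hf)
  · obtain rfl : f' = f := hf'
    have hfk : Function.Injective (fun x => f' (k x)) := by
      intro x x' hxx
      refine hi ?_
      rw [hgk]
      exact congrArg g hxx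
    have hkinj : Function.Injective k := fun x x' hxx => hfk (congrArg f' hxx)
    refine hfG (mem_of_injective_mem hs hSG hhG hh hk hkinj ?_ hf)
    refine le_antisymm (mk_set_le _) ?_
    by_contra! hlt
    have hsub : f' ⁻¹' {y} ⊆ (Set.range k)ᶜ ∪ (f' ⁻¹' {y} ∩ Set.range k) := by
      intro x hx
      by_cases hxk : x ∈ Set.range k
      · exact Or.inr ⟨hx, hxk⟩
      · exact Or.inl hxk
    have hone : #(f' ⁻¹' {y} ∩ Set.range k : Set X) ≤ 1 := by
      rw [mk_le_one_iff_set_subsingleton]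
      rintro _ ⟨hx, x, rfl⟩ _ ⟨hx', x', rfl⟩
      exact congrArg k (hfk (hx.trans hx'.symm))
    have := (mk_le_mk_of_subset hsub).trans_lt ((mk_union_le _ _).trans_lt
      (add_lt_of_lt (aleph0_le_mk X) hlt
        (hone.trans_lt (one_lt_aleph0.trans_le (aleph0_le_mk X)))))
    exact this.ne hy

/-- The nonempty fibers of `f` are one fiber of full cardinality and, for every `β ∈ B`, one
fiber of cardinality `ℵ_ (w β + 1)`. -/
def HasSuccessorFibers {X L : Type u} (w : L → Ordinal.{u}) (B : Set L) (f : X → X) : Prop :=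
  ∃ (y₀ : X) (p : L → X), #(f ⁻¹' {y₀}) = #X ∧
    (∀ β ∈ B, #(f ⁻¹' {p β}) = Cardinal.aleph (w β + 1)) ∧
    ∀ x, f x = y₀ ∨ ∃ β ∈ B, f x = p β

theorem HasSuccessorFibers.comp_bijective {X L : Type u} {w : L → Ordinal.{u}} {B : Set L}
    {f : X → X} (hf : HasSuccessorFibers w B f) {σ : X → X} (hσ : Function.Bijective σ) :
    HasSuccessorFibers w B (f ∘ σ) := by
  obtain ⟨y₀, p, h₀, hB, hx⟩ := hf
  have key : ∀ y, #((f ∘ σ) ⁻¹' {y}) = #(f ⁻¹' {y}) := fun y =>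
    mk_preimage_equiv (Equiv.ofBijective σ hσ) (f ⁻¹' {y})
  exact ⟨y₀, p, (key _).trans h₀, fun β hβ => (key _).trans (hB β hβ), fun x => hx (σ x)⟩

theorem HasSuccessorFibers.subset_of_eq_comp {X L : Type u} {w : L → Ordinal.{u}}
    (hw : Function.Injective w) (hwX : ∀ l, Cardinal.aleph (w l + 1) < #X) {A B : Set L}
    {f g k : X → X} (hf : HasSuccessorFibers w A f) (hk : HasSuccessorFibers w B k)
    (hgk : f = g ∘ k) : A ⊆ B := by
  obtain ⟨-, p, -, hA, -⟩ := hf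
  obtain ⟨y₀, q, h₀, hB, hx⟩ := hk
  intro β hβ
  by_contra hβB
  have hfib : ∀ z ∈ f ⁻¹' {p β}, k ⁻¹' {k z} ⊆ f ⁻¹' {p β} := by
    intro z hz z' hz'
    have h1 : k z' = k z := hz'
    have h2 : f z' = f z := by rw [hgk]; exact congrArg g h1
    exact h2.trans hz
  let s : Set L := {γ | γ ∈ B ∧ w γ < w β}
  have hcov : f ⁻¹' {p β} ⊆ ⋃ γ ∈ s, k ⁻¹' {q γ} := by
    intro z hz
    have hle : #(k ⁻¹' {k z}) ≤ Cardinal.aleph (w β + 1) :=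
      (mk_le_mk_of_subset (hfib z hz)).trans (hA β hβ).le
    rcases hx z with h | ⟨γ, hγ, h⟩
    · rw [h, h₀] at hle
      exact absurd hle (not_le.2 (hwX β))
    · rw [h, hB γ hγ, aleph_le_aleph] at hle
      have hle' : w γ ≤ w β :=
        Order.lt_add_one_iff.1 ((Order.lt_add_one_iff.2 le_rfl).trans_le hle)
      have hne : w γ ≠ w β := fun h' => hβB (hw h' ▸ hγ)
      exact Set.mem_biUnion (show γ ∈ s from ⟨hγ, lt_of_le_of_ne hle' hne⟩) h
  have hs : #s ≤ Cardinal.aleph (w β) := by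
    refine le_trans ?_ (Ordinal.card_le_aleph (w β))
    rw [← mk_toType]
    refine mk_le_of_injective (f := fun γ : s => Ordinal.ToType.mk ⟨w γ.1, γ.2.2⟩) ?_
    intro γ γ' h
    exact Subtype.ext (hw (congrArg Subtype.val (Ordinal.ToType.mk.injective h)))
  have hlt : #(f ⁻¹' {p β}) ≤ Cardinal.aleph (w β) := by
    refine (mk_le_mk_of_subset hcov).trans ((mk_biUnion_le _ _).trans
      (mul_le_of_le (aleph0_le_aleph _) hs (ciSup_le' fun γ => ?_)))
    rw [hB γ.1 γ.2.1, aleph_le_aleph]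
    exact Order.add_one_le_of_lt γ.2.2
  rw [hA β hβ, aleph_le_aleph] at hlt
  exact absurd hlt (not_le.2 (Order.lt_add_one_iff.2 le_rfl))

theorem exists_hasSuccessorFibers {X L : Type u} [Infinite X] {w : L → Ordinal.{u}}
    (hwX : ∀ l, Cardinal.aleph (w l + 1) < #X) (hL : #L ≤ #X) (B : Set L) :
    ∃ f : X → X, #((Set.range f)ᶜ : Set X) = #X ∧ HasSuccessorFibers w B f := by
  have hω := aleph0_le_mk X
  obtain ⟨a, ha, hac, -⟩ :=
    exists_injective_extension (X := X) (T := PEmpty.{u + 1}) PEmpty.elim PEmpty.elim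
      (fun x => x.elim) (fun x => x.elim) (by rw [Set.range_eq_empty, Set.compl_empty, mk_univ])
  obtain ⟨j⟩ : Nonempty (Option L ↪ X) := by
    refine (?_ : #(Option L) ≤ #X)
    rw [mk_option]
    exact add_le_of_le hω hL (one_lt_aleph0.le.trans hω)
  let S := (Σ β : B, (Cardinal.aleph (w β + 1)).out) ⊕ X
  obtain ⟨e⟩ : Nonempty (X ≃ S) := by
    refine Cardinal.eq.1 (le_antisymm ?_ ?_)
    · exact mk_le_of_injective (f := fun x => (Sum.inr x : S)) Sum.inr_injective
    · have h1 : #(Σ β : B, (Cardinal.aleph (w β + 1)).out) ≤ #X := by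
        rw [mk_sigma]
        refine (sum_le_mk_mul_iSup _).trans (mul_le_of_le hω ((mk_set_le B).trans hL)
          (ciSup_le' fun β => ?_))
        rw [mk_out]
        exact (hwX β).le
      change #(_ ⊕ X) ≤ #X
      rw [mk_sum, lift_id, lift_id]
      exact add_le_of_le hω h1 le_rfl
  let m : S → Option L := Sum.elim (fun z => some z.1.1) (fun _ => none)
  have hfib : ∀ o, #((fun x => a (j (m (e x)))) ⁻¹' {a (j o)}) = #(m ⁻¹' {o}) := by
    intro o
    rw [← mk_preimage_equiv e]
    congr 2
    ext x
    exact ⟨fun h => j.injective (ha h), fun h => congrArg (fun o => a (j o)) h⟩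
  refine ⟨fun x => a (j (m (e x))), le_antisymm (mk_set_le _) ?_,
    a (j none), fun β => a (j (some β)), ?_, fun β hβ => ?_, fun x => ?_⟩
  · rw [← hac]
    exact mk_le_mk_of_subset (Set.compl_subset_compl.2 (by rintro _ ⟨x, rfl⟩; exact ⟨_, rfl⟩))
  · rw [hfib]
    have : m ⁻¹' {none} = Set.range (Sum.inr : X → S) := by
      ext z
      rcases z with z | z <;> simp [m]
    rw [this, mk_range_eq _ Sum.inr_injective]
  · rw [hfib]
    have : m ⁻¹' {some β} =
        Set.range (fun z : (Cardinal.aleph (w β + 1)).out => (Sum.inl ⟨⟨β, hβ⟩, z⟩ : S)) := by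
      ext z
      constructor
      · rcases z with ⟨⟨γ, hγ⟩, z⟩ | z
        · intro h
          obtain rfl : γ = β := Option.some.inj h
          exact ⟨z, rfl⟩
        · intro h
          exact absurd h (by simp [m])
      · rintro ⟨z, rfl⟩
        rfl
    rw [this, mk_range_eq, mk_out]
    intro z z' h
    exact eq_of_heq (Sigma.mk.inj (Sum.inl.inj h)).2
  · rcases h : e x with z | z
    · exact Or.inr ⟨z.1.1, z.1.2, by simp [h, m]⟩
    · exact Or.inl (by simp [h, m])

/-- Twice as many successor cardinals yield an antichain indexed by all sets. -/
theorem eq_of_image_union_image_compl_subset {L : Type u} {C D : Set L}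
    (h : (Sum.inl '' C ∪ Sum.inr '' Cᶜ : Set (L ⊕ L)) ⊆ Sum.inl '' D ∪ Sum.inr '' Dᶜ) :
    C = D := by
  ext l
  constructor
  · intro hl
    simpa using h (Or.inl ⟨l, hl, rfl⟩)
  · intro hl
    by_contra hC
    have := h (Or.inr ⟨l, hC, rfl⟩)
    simp [hl] at this

/-- The number of fibers of `f` of each cardinality, empty fibers included. -/
noncomputable def fiberSpectrum {X : Type u} (f : X → X) (ξ : Set.Iic #X) : Set.Iic #X :=
  ⟨#{y : X // #(f ⁻¹' {y}) = ξ}, mk_subtype_le _⟩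

theorem exists_perm_of_fiberSpectrum_eq {X : Type u} {f g : X → X}
    (h : fiberSpectrum f = fiberSpectrum g) :
    ∃ σ τ : X ≃ X, ∀ x, g (τ x) = σ (f x) := by
  let F : (X → X) → X → Set.Iic #X := fun f y => ⟨#(f ⁻¹' {y}), mk_set_le _⟩
  have hF : ∀ (f : X → X) ξ, #{y // F f y = ξ} = (fiberSpectrum f ξ : Cardinal) := by
    intro f ξ
    refine mk_congr (Equiv.subtypeEquivRight fun y => ?_)
    exact Subtype.ext_iff
  have hfg : ∀ ξ, Nonempty ({y // F f y = ξ} ≃ {y // F g y = ξ}) := fun ξ =>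
    Cardinal.eq.1 (by rw [hF, hF, h])
  let σ : X ≃ X := (Equiv.sigmaFiberEquiv (F f)).symm.trans
    ((Equiv.sigmaCongrRight fun ξ => (hfg ξ).some).trans (Equiv.sigmaFiberEquiv (F g)))
  have hσ : ∀ y, F g (σ y) = F f y := fun y => ((hfg (F f y)).some ⟨y, rfl⟩).2
  have hfib : ∀ y, Nonempty ({x // f x = y} ≃ {x // g x = σ y}) := fun y =>
    Cardinal.eq.1 (congrArg Subtype.val (hσ y)).symm
  have hfib' : ∀ y, Nonempty ({x // f x = y} ≃ {x // σ.symm (g x) = y}) := fun y =>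
    ⟨(hfib y).some.trans (Equiv.subtypeEquivRight fun x => (Equiv.symm_apply_eq σ).symm)⟩
  let τ : X ≃ X := (Equiv.sigmaFiberEquiv f).symm.trans
    ((Equiv.sigmaCongrRight fun y => (hfib' y).some).trans
      (Equiv.sigmaFiberEquiv fun x => σ.symm (g x)))
  refine ⟨σ, τ, fun x => ?_⟩
  have : σ.symm (g (τ x)) = f x := ((hfib' (f x)).some ⟨x, rfl⟩).2
  exact (Equiv.symm_apply_eq σ).1 this

theorem mem_of_fiberSpectrum_eq {X : Type u} {M : Submonoid (Function.End X)}
    (hM : permSubmonoid X ≤ M) {f g : Function.End X} (hf : f ∈ M)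
    (h : fiberSpectrum f = fiberSpectrum g) : g ∈ M := by
  obtain ⟨σ, τ, hστ⟩ := exists_perm_of_fiberSpectrum_eq h
  let s : Function.End X := fun x => σ x
  let t : Function.End X := fun x => τ.symm x
  have hs : s ∈ M := hM σ.bijective
  have ht : t ∈ M := hM τ.symm.bijective
  have : g = s * f * t := by
    funext x
    change g x = σ (f (τ.symm x))
    rw [← hστ, Equiv.apply_symm_apply]
  rw [this]
  exact M.mul_mem (M.mul_mem hs hf) ht

theorem mk_Iic_aleph_le (α : Ordinal.{u}) :
    #(Set.Iic (Cardinal.aleph α)) ≤ Cardinal.lift.{u + 1} (max α.card ℵ₀) := by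
  have h1 : #(Set.Iic (Cardinal.aleph α)) ≤ #(Set.Iio (Ordinal.omega0 + α + 1)) := by
    refine mk_le_of_injective (f := fun c => ⟨preAleph.symm c.1, ?_⟩) ?_
    · rw [Set.mem_Iio, Order.lt_add_one_iff, ← preAleph_symm_aleph]
      exact preAleph.symm.monotone c.2
    · intro c d h
      exact Subtype.ext (preAleph.symm.injective (Subtype.mk.inj h))
  refine h1.trans ?_
  rw [mk_Iio_ordinal, lift_le, Ordinal.card_add, Ordinal.card_add, Ordinal.card_omega0,
    Ordinal.card_one]
  have h2 : ℵ₀ ≤ max α.card ℵ₀ := le_max_right _ _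
  exact add_le_of_le h2 (add_le_of_le h2 h2 (le_max_left _ _)) (one_lt_aleph0.le.trans h2)

/-- There are at most `2 ^ (2 ^ λ)` submonoids containing the permutations. -/
theorem mk_submonoid_ge_permSubmonoid_le {X : Type u} {α : Ordinal.{u}}
    (hκ : #X = Cardinal.aleph α) (G : Submonoid (Function.End X)) :
    #{M : Submonoid (Function.End X) // permSubmonoid X ≤ M ∧ M ≤ G} ≤
      (2 : Cardinal.{u}) ^ ((2 : Cardinal.{u}) ^ max α.card ℵ₀) := by
  rw [← lift_le.{u + 1}]
  have h1 : Cardinal.lift.{u + 1}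
      #{M : Submonoid (Function.End X) // permSubmonoid X ≤ M ∧ M ≤ G} ≤
      #(Set (Set.Iic #X → Set.Iic #X)) := by
    rw [← Cardinal.mk_uLift]
    refine mk_le_of_injective
      (f := fun M => fiberSpectrum (X := X) '' (M.down.1 : Set (Function.End X))) ?_
    have key : ∀ M N : {M : Submonoid (Function.End X) // permSubmonoid X ≤ M ∧ M ≤ G},
        fiberSpectrum (X := X) '' (M.1 : Set (Function.End X)) =
          fiberSpectrum (X := X) '' (N.1 : Set (Function.End X)) → M.1 ≤ N.1 := by
      intro M N h f hf
      obtain ⟨g, hg, hgf⟩ := h.subset ⟨f, hf, rfl⟩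
      exact mem_of_fiberSpectrum_eq N.2.1 hg hgf
    intro M N h
    exact ULift.ext _ _ (Subtype.ext (le_antisymm (key _ _ h) (key _ _ h.symm)))
  refine h1.trans ?_
  have hle := mk_Iic_aleph_le α
  rw [← hκ] at hle
  have hω : ℵ₀ ≤ max α.card ℵ₀ := le_max_right _ _
  rw [mk_set, ← power_def, lift_power, lift_two, lift_power, lift_two]
  refine power_le_power_left two_ne_zero ?_
  rw [← power_self_eq (aleph0_le_lift.2 hω)]
  exact (power_le_power_right hle).trans (power_le_power_left
    (aleph0_pos.trans_le (aleph0_le_lift.2 hω)).ne' hle)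

/-- On an infinite set of singular cardinality `κ = ℵ_α`, for every precomplete submonoid
`G ≠ A'` containing the permutations, the power set of `2^λ` order-embeds into the interval
`[S, G]`; in particular `|[S, G]| = 2^(2^λ)`, where `λ = max(|α|, ℵ₀)`. -/
theorem embedding_into_interval_S_G_singular {X : Type u} [Infinite X] {α : Ordinal.{u}}
    (hκ : #X = Cardinal.aleph α) (hsing : ¬(Cardinal.aleph α).IsRegular)
    (lam : Cardinal.{u}) (hlam : lam = max α.card ℵ₀)
    (G : Submonoid (Function.End X)) (hG : Precomplete G) (hSG : permSubmonoid X ≤ G)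
    (hGA : (G : Set (Function.End X)) ≠ monA' X) :
    Nonempty (Set (Quotient.out ((2 : Cardinal.{u}) ^ lam)) ↪o
        {M : Submonoid (Function.End X) // permSubmonoid X ≤ M ∧ M ≤ G}) ∧
    #{M : Submonoid (Function.End X) // permSubmonoid X ≤ M ∧ M ≤ G} =
      (2 : Cardinal.{u}) ^ ((2 : Cardinal.{u}) ^ lam) := by
  have hα : Order.IsSuccLimit α := by
    rcases Ordinal.zero_or_succ_or_isSuccLimit α with rfl | ⟨β, rfl⟩ | h
    · exact absurd (by rw [aleph_zero]; exact isRegular_aleph0) hsing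
    · exact absurd (isRegular_aleph_add_one β) hsing
    · exact h
  have hωα : ℵ₀ ≤ α.card := Ordinal.aleph0_le_card.2 (Ordinal.omega0_le_of_isSuccLimit hα)
  have hlam' : lam = #α.ToType := by rw [hlam, max_eq_left hωα, mk_toType]
  have : Infinite α.ToType := infinite_iff.2 (by rwa [mk_toType])
  have hLX : #α.ToType ≤ #X := by
    rw [mk_toType, hκ]
    exact Ordinal.card_le_aleph α
  have hsX : ¬ (#X).IsRegular := hκ ▸ hsing
  obtain ⟨e⟩ := Cardinal.eq.1 (mk_sum_self (X := α.ToType))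
  let w : α.ToType ⊕ α.ToType → Ordinal.{u} := fun l => (e l).toOrd
  have hw : Function.Injective w := fun l l' h =>
    e.injective (Ordinal.ToType.mk.symm.injective (Subtype.ext h))
  have hwX : ∀ l, Cardinal.aleph (w l + 1) < #X := by
    intro l
    rw [hκ, aleph_lt_aleph]
    exact hα.add_one_lt (e l).toOrd.2
  choose f hfc hf using exists_hasSuccessorFibers hwX (mk_sum_self.le.trans hLX)
  obtain ⟨ψ⟩ : Nonempty (Quotient.out ((2 : Cardinal.{u}) ^ lam) ≃ Set α.ToType) :=
    Cardinal.eq.1 (by rw [mk_out, mk_set, hlam'])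
  let F : Quotient.out ((2 : Cardinal.{u}) ^ lam) → Function.End X :=
    fun c => f (Sum.inl '' ψ c ∪ Sum.inr '' (ψ c)ᶜ)
  have hFG : ∀ c, F c ∈ G := fun c => by
    obtain ⟨y, -, hy, -⟩ := hf (Sum.inl '' ψ c ∪ Sum.inr '' (ψ c)ᶜ)
    exact mem_of_precomplete hsX hG hSG hGA (hfc _) hy
  have hFinj : ∀ c, ¬ Function.Injective (F c) := fun c hc => by
    obtain ⟨y, -, hy, -⟩ := hf (Sum.inl '' ψ c ∪ Sum.inr '' (ψ c)ᶜ)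
    have h1 : #(F c ⁻¹' {y}) ≤ 1 := by
      rw [mk_le_one_iff_set_subsingleton]
      exact fun x hx x' hx' => hc (Eq.trans hx hx'.symm)
    rw [show #(F c ⁻¹' {y}) = #X from hy] at h1
    exact absurd h1 (not_le.2 (one_lt_aleph0.trans_le (aleph0_le_mk X)))
  have hmem : ∀ c (b : Set (Quotient.out ((2 : Cardinal.{u}) ^ lam))),
      F c ∈ Submonoid.closure ((permSubmonoid X : Set (Function.End X)) ∪ F '' b) → c ∈ b := by
    intro c b hcb
    rcases mem_closure_union_iff_exists hcb with h | ⟨g, _, ⟨d, hd, rfl⟩, σ, hσ, h⟩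
    · exact absurd h.1 (hFinj c)
    · have hsub := HasSuccessorFibers.subset_of_eq_comp (g := g) hw hwX (hf _)
        ((hf _).comp_bijective hσ) h
      rwa [ψ.injective (eq_of_image_union_image_compl_subset hsub)]
  let Φ : Set (Quotient.out ((2 : Cardinal.{u}) ^ lam)) ↪o
      {M : Submonoid (Function.End X) // permSubmonoid X ≤ M ∧ M ≤ G} :=
    OrderEmbedding.ofMapLEIff
      (fun b => ⟨Submonoid.closure ((permSubmonoid X : Set (Function.End X)) ∪ F '' b),
        fun x hx => Submonoid.subset_closure (Or.inl hx),
        Submonoid.closure_le.2 (Set.union_subset hSG (by rintro _ ⟨c, -, rfl⟩; exact hFG c))⟩)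
      (fun a b => ⟨fun h c hc => hmem c b (h (Submonoid.subset_closure (Or.inr ⟨c, hc, rfl⟩))),
        fun h => Submonoid.closure_mono (Set.union_subset_union_right _ (Set.image_mono h))⟩)
  refine ⟨⟨Φ⟩, le_antisymm ?_ ?_⟩
  · rw [hlam]
    exact mk_submonoid_ge_permSubmonoid_le hκ G
  · have := mk_le_of_injective Φ.injective
    rwa [mk_set, mk_out] at this
end
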